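/- arXiv:2003.05236 — 2 statements merged into one kernel-verified Lean document; each statement's English description precedes it below -/
import Mathlib

section
/- Let w be an odd positive integer, ε ∈ {+1,−1}, and C ∈ V_w^ε. Then C(X,Y) − C(X+Y,Y) − ε·C(X+Y,X) lies in V_w^{−ε} if and only if there exist p ∈ W_{w−1}^{−ε} and q ∈ W_{w+1}^{ε} such that C(X,Y) = X·p(X,Y) + (∂q/∂Y)(X,Y). -/
open MvPolynomial

/-- Substitution: `sub2 a b p` is `p(a, b)` for a bivariate polynomial `p(X,Y)`. -/
noncomputable def sub2 (a b p : MvPolynomial (Fin 2) ℚ) : MvPolynomial (Fin 2) ℚ :=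
  aeval ![a, b] p

/-- `memV w ε p` : `p ∈ V_w^ε`, i.e. `p` is homogeneous of degree `w` and
`p(-X,Y) = ε p(X,Y)`. -/
def memV (w : ℕ) (ε : ℤ) (p : MvPolynomial (Fin 2) ℚ) : Prop :=
  p.IsHomogeneous w ∧ sub2 (-X 0) (X 1) p = (ε : ℚ) • p

/-- `memW w ε p` : `p ∈ W_w^ε`, the space of period polynomials: `p ∈ V_w^ε` with
`p(X,Y) + p(-Y,X) = 0` and `p(X,Y) + p(X-Y,X) + p(-Y,X-Y) = 0`. -/
def memW (w : ℕ) (ε : ℤ) (p : MvPolynomial (Fin 2) ℚ) : Prop :=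
  memV w ε p ∧
  p + sub2 (-X 1) (X 0) p = 0 ∧
  p + sub2 (X 0 - X 1) (X 0) p + sub2 (-X 1) (X 0 - X 1) p = 0


section Substitution

variable (a b c d p q : MvPolynomial (Fin 2) ℚ)

lemma sub2_add : sub2 a b (p + q) = sub2 a b p + sub2 a b q := map_add _ _ _

lemma sub2_sub : sub2 a b (p - q) = sub2 a b p - sub2 a b q := map_sub _ _ _

lemma sub2_neg : sub2 a b (-p) = -sub2 a b p := map_neg _ _

lemma sub2_mul : sub2 a b (p * q) = sub2 a b p * sub2 a b q := map_mul _ _ _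

lemma sub2_zero : sub2 a b 0 = 0 := map_zero _

lemma sub2_C (r : ℚ) : sub2 a b (C r) = C r := aeval_C _ _

lemma sub2_X_zero : sub2 a b (X 0) = a := by simp [sub2]

lemma sub2_X_one : sub2 a b (X 1) = b := by simp [sub2]

lemma sub2_X : sub2 (X 0) (X 1) p = p := by
  have h : (![X 0, X 1] : Fin 2 → MvPolynomial (Fin 2) ℚ) = X := by
    ext1 i; fin_cases i <;> rfl
  rw [sub2, h, aeval_X_left_apply]

lemma sub2_sub2 : sub2 a b (sub2 c d p) = sub2 (sub2 a b c) (sub2 a b d) p := by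
  have h : (aeval ![a, b]).comp (aeval ![c, d]) =
      aeval (R := ℚ) ![aeval ![a, b] c, aeval ![a, b] d] := by
    ext1 i
    fin_cases i <;> simp
  exact DFunLike.congr_fun h p

lemma pderiv_sub2 (i : Fin 2) : pderiv i (sub2 a b p) =
    sub2 a b (pderiv 0 p) * pderiv i a + sub2 a b (pderiv 1 p) * pderiv i b := by
  induction p using MvPolynomial.induction_on with
  | C r => simp [sub2_C, sub2_zero]
  | add p q hp hq => simp only [sub2_add, map_add, hp, hq]; ring
  | mul_X p j hp =>
    fin_cases j <;> fin_cases i <;>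
    simp [sub2_mul, sub2_add, sub2_X_zero, sub2_X_one, pderiv_X] at hp ⊢ <;>
    rw [hp] <;> ring

variable {a b c d p q}

lemma sub2_isHomogeneous {n : ℕ} (hp : p.IsHomogeneous n) (ha : a.IsHomogeneous 1)
    (hb : b.IsHomogeneous 1) : (sub2 a b p).IsHomogeneous n := by
  have h := hp.aeval ![a, b] (n := 1) (by intro i; fin_cases i <;> assumption)
  rwa [one_mul] at h

lemma sub2_neg_neg_of_odd {n : ℕ} (hn : Odd n) (hp : p.IsHomogeneous n) :
    sub2 (-a) (-b) p = -sub2 a b p := by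
  simp only [sub2, aeval_def, eval₂_eq', Fin.prod_univ_two, Matrix.cons_val_zero,
    Matrix.cons_val_one, ← Finset.sum_neg_distrib]
  refine Finset.sum_congr rfl fun m hm => ?_
  have h : m 0 + m 1 = n := by
    have := hp.degree_eq_sum_deg_support hm
    rw [this]
    exact (Fin.sum_univ_two m).symm.trans (Finsupp.degree_eq_sum m).symm
  have h' : (-1 : MvPolynomial (Fin 2) ℚ) ^ m 0 * (-1) ^ m 1 = -1 := by
    rw [← pow_add, h, hn.neg_one_pow]
  rw [neg_pow a, neg_pow b]
  linear_combination (algebraMap ℚ (MvPolynomial (Fin 2) ℚ) (p.coeff m) * a ^ m 0 * b ^ m 1) * h'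

end Substitution

section PeriodRelations

variable {w : ℕ} {ε : ℤ} {p q c : MvPolynomial (Fin 2) ℚ}

lemma C_sign_mul_self (hε : ε = 1 ∨ ε = -1) :
    (C (ε : ℚ) * C (ε : ℚ) : MvPolynomial (Fin 2) ℚ) = 1 := by
  rcases hε with rfl | rfl <;> simp

lemma memV.sub2_neg_left (hp : memV w ε p) (a b : MvPolynomial (Fin 2) ℚ) :
    sub2 (-a) b p = C (ε : ℚ) * sub2 a b p := by
  have h := congrArg (sub2 a b) hp.2
  simpa only [smul_eq_C_mul, sub2_mul, sub2_C, sub2_sub2, sub2_neg, sub2_X_zero, sub2_X_one]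
    using h

lemma memV.sub2_neg_right (hw : Odd w) (hp : memV w ε p) (a b : MvPolynomial (Fin 2) ℚ) :
    sub2 a (-b) p = -C (ε : ℚ) * sub2 a b p := by
  have h := sub2_neg_neg_of_odd (a := -a) (b := b) hw hp.1
  rw [neg_neg, hp.sub2_neg_left] at h
  rw [h, neg_mul]

lemma sub2_neg_swap (h : p + sub2 (-X 1) (X 0) p = 0) (a b : MvPolynomial (Fin 2) ℚ) :
    sub2 (-b) a p = -sub2 a b p := by
  have h := congrArg (sub2 a b) h
  simp only [sub2_add, sub2_sub2, sub2_neg, sub2_X_zero, sub2_X_one, sub2_zero] at h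
  linear_combination h

/-- The component along the second variable of the three-term relation for the vector
`(-c(-Y,X), c(X,Y))`. -/
noncomputable def threeTerm (c : MvPolynomial (Fin 2) ℚ) : MvPolynomial (Fin 2) ℚ :=
  c + sub2 (-X 0) (X 0 - X 1) c + sub2 (X 1 - X 0) (-X 1) c - sub2 (-X 1) (X 0 - X 1) c

lemma threeTerm_add : threeTerm (p + q) = threeTerm p + threeTerm q := by
  simp only [threeTerm, sub2_add]; ring

lemma threeTerm_X_mul (h : p + sub2 (-X 1) (X 0) p = 0) :
    threeTerm (X 0 * p) =
      X 0 * (p + sub2 (X 0 - X 1) (X 0) p + sub2 (-X 1) (X 0 - X 1) p) := by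
  have h₁ := sub2_neg_swap h (X 0 - X 1) (X 0)
  have h₂ := sub2_neg_swap h (-X 1) (X 0 - X 1)
  rw [neg_sub] at h₂
  simp only [threeTerm, sub2_mul, sub2_X_zero]
  linear_combination (-X 0) * h₁ + (X 1 - X 0) * h₂

lemma threeTerm_pderiv (h : q + sub2 (-X 1) (X 0) q = 0)
    (h' : q + sub2 (X 0 - X 1) (X 0) q + sub2 (-X 1) (X 0 - X 1) q = 0) :
    threeTerm (pderiv 1 q) = 0 := by
  have hS := congrArg (pderiv 0) h
  have hU := congrArg (pderiv 1) h'
  simp [pderiv_sub2, pderiv_X] at hS hU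
  have h₁ := congrArg (sub2 (X 0 - X 1) (X 0)) hS
  have h₂ := congrArg (sub2 (-X 1) (X 0 - X 1)) hS
  simp only [sub2_add, sub2_sub2, sub2_neg, sub2_X_zero, sub2_X_one, sub2_zero, neg_sub] at h₁ h₂
  rw [threeTerm]
  linear_combination hU + h₁ + h₂

lemma memV.threeTerm_eq (hw : Odd w) (hc : memV w ε c) :
    threeTerm c = c + C (ε : ℚ) * sub2 (X 0) (X 0 - X 1) c -
      sub2 (X 0 - X 1) (X 1) c - C (ε : ℚ) * sub2 (X 1) (X 0 - X 1) c := by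
  have h : sub2 (-(X 0 - X 1)) (-X 1) c = -sub2 (X 0 - X 1) (X 1) c :=
    sub2_neg_neg_of_odd hw hc.1
  rw [neg_sub] at h
  rw [threeTerm, hc.sub2_neg_left, hc.sub2_neg_left, h]
  ring

lemma memV_difference_iff (hw : Odd w) (hε : ε = 1 ∨ ε = -1) (hc : memV w ε c) :
    memV w (-ε) (c - sub2 (X 0 + X 1) (X 1) c - (ε : ℚ) • sub2 (X 0 + X 1) (X 0) c) ↔
      threeTerm c = 0 := by
  have he := C_sign_mul_self hε
  have hl := hc.sub2_neg_left
  have hr := hc.sub2_neg_right hw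
  have key : threeTerm c = 0 ↔
      c - sub2 (X 0 + X 1) (X 1) c - C (ε : ℚ) * sub2 (X 0 + X 1) (X 0) c =
        -C (ε : ℚ) * sub2 (X 1) (X 0) c := by
    have ht := hc.threeTerm_eq hw
    constructor <;> intro h
    · have h' := congrArg (sub2 (X 0 + X 1) (X 1)) (ht.symm.trans h)
      simp only [sub2_add, sub2_sub, sub2_mul, sub2_C, sub2_sub2, sub2_X_zero, sub2_X_one,
        sub2_zero, add_sub_cancel_right, sub2_X] at h'
      linear_combination -h'
    · have h' := congrArg (sub2 (X 0 - X 1) (X 1)) h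
      simp only [sub2_add, sub2_sub, sub2_mul, sub2_neg, sub2_C, sub2_sub2, sub2_X_zero,
        sub2_X_one, sub_add_cancel, sub2_X] at h'
      rw [ht]
      linear_combination -h'
  rw [smul_eq_C_mul, key]
  refine ⟨fun hD => ?_, fun hD => ?_⟩
  · have hD' := hD.sub2_neg_left
    set E := c - sub2 (X 0 + X 1) (X 1) c - C (ε : ℚ) * sub2 (X 0 + X 1) (X 0) c +
      C (ε : ℚ) * sub2 (X 1) (X 0) c with hE
    have hEl (a b) : sub2 (-a) b E = -C (ε : ℚ) * sub2 a b E := by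
      have h := hD' a b
      rw [hE, sub2_add, h, sub2_add]
      simp only [Int.cast_neg, map_neg, sub2_mul, sub2_C, sub2_sub2, sub2_X_zero, sub2_X_one, hr]
      ring
    have hEs (a b) : sub2 b a E = C (ε : ℚ) * sub2 a b E := by
      simp only [hE, sub2_add, sub2_sub, sub2_mul, sub2_C, sub2_sub2, sub2_X_zero, sub2_X_one,
        add_comm b a]
      linear_combination (sub2 (a + b) a c - sub2 b a c) * he
    have hE0 : E = 0 := by
      have hEn : sub2 (-X 0) (-X 1) E = -sub2 (X 0) (X 1) E :=
        sub2_neg_neg_of_odd hw (hD.1.add ((sub2_isHomogeneous hc.1 (isHomogeneous_X _ _)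
          (isHomogeneous_X _ _)).C_mul _))
      have h : sub2 (-X 0) (-X 1) E = sub2 (X 0) (X 1) E := by
        rw [hEl, hEs, hEl, hEs]
        linear_combination (sub2 (X 0) (X 1) E * (C (ε : ℚ) * C (ε : ℚ) + 1)) * he
      rw [hEn, sub2_X, neg_eq_iff_add_eq_zero, add_self_eq_zero] at h
      exact h
    linear_combination hE0
  · rw [hD]
    refine ⟨?_, ?_⟩
    · rw [← map_neg]
      exact (sub2_isHomogeneous hc.1 (isHomogeneous_X _ _) (isHomogeneous_X _ _)).C_mul _
    · simp only [smul_eq_C_mul, sub2_mul, sub2_neg, sub2_C, sub2_sub2, sub2_X_zero, sub2_X_one,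
        hr, Int.cast_neg, map_neg]

lemma exists_eq_X_mul_add_pderiv (hw : Odd w) (hε : ε = 1 ∨ ε = -1) (hc : memV w ε c)
    (hT : threeTerm c = 0) :
    ∃ p q : MvPolynomial (Fin 2) ℚ, memW (w - 1) (-ε) p ∧ memW (w + 1) ε q ∧
      c = X 0 * p + pderiv 1 q := by
  have he := C_sign_mul_self hε
  have hl := hc.sub2_neg_left
  have hr := hc.sub2_neg_right hw
  set e : MvPolynomial (Fin 2) ℚ := C (ε : ℚ) with he'
  set k : MvPolynomial (Fin 2) ℚ := C ((w + 1 : ℚ)⁻¹) with hk'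
  have hk : k * (w + 1) = 1 := by
    have h : (w + 1 : MvPolynomial (Fin 2) ℚ) = C (w + 1 : ℚ) := by simp
    rw [h, hk', ← C_mul, inv_mul_cancel₀ (by positivity), C_1]
  have hkd (i) : pderiv i k = 0 := pderiv_C
  have hk0 (a b) : sub2 a b k = k := sub2_C _ _ _
  have he0 (a b) : sub2 a b e = e := sub2_C _ _ _
  have hed (i) : pderiv i e = 0 := pderiv_C
  have hX0 := isHomogeneous_X ℚ (0 : Fin 2)
  have hX1 := isHomogeneous_X ℚ (1 : Fin 2)
  set A : MvPolynomial (Fin 2) ℚ := -e * sub2 (X 1) (X 0) c with hA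
  have hAhom : A.IsHomogeneous w := by
    rw [hA, he', ← map_neg]
    exact (sub2_isHomogeneous hc.1 hX1 hX0).C_mul _
  have hA0 (a b) : sub2 a b A = -e * sub2 b a c := by
    simp only [hA, sub2_mul, sub2_neg, he0, sub2_sub2, sub2_X_zero, sub2_X_one]
  have hcE : X 0 * pderiv 0 c + X 1 * pderiv 1 c = (w : MvPolynomial (Fin 2) ℚ) * c := by
    simpa using hc.1.sum_X_mul_pderiv
  have hAE : X 0 * pderiv 0 A + X 1 * pderiv 1 A = (w : MvPolynomial (Fin 2) ℚ) * A := by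
    simpa using hAhom.sum_X_mul_pderiv
  set q : MvPolynomial (Fin 2) ℚ := k * (X 0 * A + X 1 * c) with hq
  set p : MvPolynomial (Fin 2) ℚ := k * (pderiv 0 c - pderiv 1 A) with hp
  have hq0 : pderiv 0 q = k * (A + X 0 * pderiv 0 A + X 1 * pderiv 0 c) := by
    simp only [hq, Derivation.leibniz, map_add, hkd, pderiv_X_self,
      pderiv_X_of_ne one_ne_zero, smul_eq_mul]
    ring
  have hq1 : pderiv 1 q = k * (X 0 * pderiv 1 A + c + X 1 * pderiv 1 c) := by
    simp only [hq, Derivation.leibniz, map_add, hkd, pderiv_X_self,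
      pderiv_X_of_ne zero_ne_one, smul_eq_mul]
    ring
  have hcpq : c = X 0 * p + pderiv 1 q := by
    rw [hq1, hp]
    linear_combination (-c) * hk - k * hcE
  have hApq : A = -X 1 * p + pderiv 0 q := by
    rw [hq0, hp]
    linear_combination (-A) * hk - k * hAE
  have hqV : memV (w + 1) ε q := by
    refine ⟨?_, ?_⟩
    · have h := (isHomogeneous_C (Fin 2) (w + 1 : ℚ)⁻¹).mul ((hX0.mul hAhom).add (hX1.mul hc.1))
      rwa [zero_add, add_comm 1 w] at h
    · rw [smul_eq_C_mul, ← he', hq]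
      simp only [sub2_mul, sub2_add, hk0, hA0, sub2_X_zero, sub2_X_one, hl, hr, sub2_X]
      rw [hA]
      ring
  have hqS : q + sub2 (-X 1) (X 0) q = 0 := by
    simp only [hq, sub2_mul, sub2_add, hk0, hA0, sub2_X_zero, sub2_X_one, hl, hr, sub2_X]
    rw [hA]
    linear_combination (-(k * X 1 * c)) * he
  have hqU : q + sub2 (X 0 - X 1) (X 0) q + sub2 (-X 1) (X 0 - X 1) q = 0 := by
    have h₁ := (hc.threeTerm_eq hw).symm.trans hT
    have h₂ := congrArg (sub2 (X 0 - X 1) (X 0)) h₁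
    rw [← he'] at h₁ h₂
    simp only [sub2_sub, sub2_mul, sub2_add, he0, sub2_sub2, sub2_X_zero, sub2_X_one, sub2_zero,
      sub_sub_cancel_left, hl, hr, sub2_X] at h₂
    simp only [hq, sub2_mul, sub2_add, hk0, hA0, sub2_X_zero, sub2_X_one, hl, hr]
    rw [hA]
    linear_combination k * X 0 * (h₂ - h₁) + k * X 1 * h₁ +
      k * ((sub2 (X 0 - X 1) (X 1) c - c) * X 0 - X 1 * sub2 (X 0 - X 1) (X 1) c) * he
  have hpS : p + sub2 (-X 1) (X 0) p = 0 := by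
    have h₁ := congrArg (sub2 (-X 1) (X 0)) hcpq
    have h₂ := congrArg (pderiv 0) hqS
    simp [pderiv_sub2, pderiv_X] at h₂
    simp only [sub2_add, sub2_mul, sub2_X_zero, hl] at h₁
    refine (mul_eq_zero.mp (?_ : X 1 * (p + sub2 (-X 1) (X 0) p) = 0)).resolve_left (X_ne_zero 1)
    linear_combination h₁ + h₂ + hApq - hA
  refine ⟨p, q, ⟨⟨?_, ?_⟩, hpS, ?_⟩, ⟨hqV, hqS, hqU⟩, hcpq⟩
  · exact (hc.1.pderiv.sub hAhom.pderiv).C_mul _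
  · have h₁ := congrArg (sub2 (-X 0) (X 1)) hcpq
    have h₂ := congrArg (pderiv 1) hqV.2
    rw [smul_eq_C_mul, ← he', pderiv_sub2, Derivation.leibniz _ e q, hed] at h₂
    simp [pderiv_X] at h₂
    simp only [sub2_add, sub2_mul, sub2_X_zero, hl, sub2_X] at h₁
    rw [smul_eq_C_mul, Int.cast_neg, map_neg, ← he']
    refine mul_left_cancel₀ (X_ne_zero (R := ℚ) (0 : Fin 2)) ?_
    linear_combination h₁ + h₂ - e * hcpq
  · have h := threeTerm_X_mul hpS
    rw [hcpq, threeTerm_add, threeTerm_pderiv hqS hqU, h, add_zero] at hT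
    exact (mul_eq_zero.mp hT).resolve_left (X_ne_zero 0)

end PeriodRelations

theorem stmt7 (w : ℕ) (hw : Odd w) (hpos : 0 < w) (ε : ℤ) (hε : ε = 1 ∨ ε = -1)
    (Cp : MvPolynomial (Fin 2) ℚ) (hC : memV w ε Cp) :
    memV w (-ε) (Cp - sub2 (X 0 + X 1) (X 1) Cp - (ε : ℚ) • sub2 (X 0 + X 1) (X 0) Cp)
      ↔ ∃ p q : MvPolynomial (Fin 2) ℚ, memW (w - 1) (-ε) p ∧ memW (w + 1) ε q ∧
          Cp = X 0 * p + pderiv 1 q := by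
  rw [memV_difference_iff hw hε hC]
  refine ⟨exists_eq_X_mul_add_pderiv hw hε hC, ?_⟩
  rintro ⟨p, q, ⟨-, hpS, hpU⟩, ⟨-, hqS, hqU⟩, rfl⟩
  rw [threeTerm_add, threeTerm_X_mul hpS, hpU, threeTerm_pderiv hqS hqU, mul_zero, add_zero]
end

section
/- Let w be a nonnegative even integer and p ∈ V_w^−. Then p(X+Y,Y) + p(X,X+Y) + p(−X+Y,Y) + p(−X,−X+Y) = 0 if and only if p satisfies both p(X,Y) + p(X−Y,X) + p(−Y,X−Y) = 0 and p(−Y,X) + p(−X,X−Y) + p(−X+Y,−Y) = 0 (that is, if and only if p is an odd period polynomial for the index-three congruence subgroup Γ_A of SL₂(ℤ)). -/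
open MvPolynomial

lemma eval_sub2 (a b p : MvPolynomial (Fin 2) ℚ) (v : Fin 2 → ℚ) :
    eval v (sub2 a b p) = eval ![eval v a, eval v b] p := by
  have h : (eval v).comp (aeval ![a, b] : MvPolynomial (Fin 2) ℚ →ₐ[ℚ] _).toRingHom
      = eval ![eval v a, eval v b] := by
    apply MvPolynomial.ringHom_ext
    · intro r
      simp
    · intro i
      fin_cases i <;> simp
  exact RingHom.congr_fun h p

lemma eq_zero_iff_eval_pair {q : MvPolynomial (Fin 2) ℚ} :
    q = 0 ↔ ∀ x y : ℚ, eval ![x, y] q = 0 := by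
  refine ⟨fun h x y => by simp [h], fun h => MvPolynomial.funext fun v => ?_⟩
  have hv : v = ![v 0, v 1] := by
    ext i
    fin_cases i <;> rfl
  rw [hv, h, map_zero]

lemma eval_neg_neg {w : ℕ} (hw : Even w) {p : MvPolynomial (Fin 2) ℚ}
    (hp : p.IsHomogeneous w) (x y : ℚ) : eval ![-x, -y] p = eval ![x, y] p := by
  rw [eval_eq', eval_eq']
  refine Finset.sum_congr rfl fun d hd => ?_
  have hd' : d 0 + d 1 = w := by
    simpa [Finsupp.weight_apply, Finsupp.sum_fintype] using hp (mem_support_iff.mp hd)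
  have hsign : (-1 : ℚ) ^ d 0 * (-1) ^ d 1 = 1 := by
    rw [← pow_add, hd', hw.neg_one_pow]
  simp only [Fin.prod_univ_two, Matrix.cons_val_zero, Matrix.cons_val_one]
  rw [neg_pow x, neg_pow y]
  linear_combination (coeff d p * x ^ d 0 * y ^ d 1) * hsign

/-- A polynomial function with a nonzero period is constant. -/
lemma Polynomial.eval_eq_eval_zero_of_periodic {Q : Polynomial ℚ} {c : ℚ} (hc : c ≠ 0)
    (h : Function.Periodic (fun x => Q.eval x) c) (x : ℚ) : Q.eval x = Q.eval 0 := by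
  have hQ : Q = Polynomial.C (Q.eval 0) := by
    refine Polynomial.eq_of_infinite_eval_eq _ _ ?_
    refine (Set.infinite_range_of_injective (f := fun n : ℕ => (n : ℚ) * c) ?_).mono ?_
    · intro m n hmn
      simpa [hc] using hmn
    · rintro _ ⟨n, rfl⟩
      simpa using h.nat_mul n 0
  rw [hQ]
  simp

/-- A bivariate polynomial that is even under `-1`, odd in the second variable and invariant
under `X ↦ X + 2Y` vanishes. -/
lemma eval_eq_zero_of_shift_invariant {q : MvPolynomial (Fin 2) ℚ}
    (hneg : ∀ x y, eval ![-x, -y] q = eval ![x, y] q)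
    (hodd : ∀ x y, eval ![x, -y] q = -eval ![x, y] q)
    (hshift : ∀ x y, eval ![x + 2 * y, y] q = eval ![x, y] q) (x y : ℚ) :
    eval ![x, y] q = 0 := by
  rcases eq_or_ne y 0 with rfl | hy
  · have := hodd x 0
    rw [neg_zero] at this
    linarith
  let Q : Polynomial ℚ := aeval ![Polynomial.X, Polynomial.C y] q
  have hQ : ∀ t, Q.eval t = eval ![t, y] q := by
    intro t
    have h : (Polynomial.evalRingHom t).comp
        (aeval ![Polynomial.X, Polynomial.C y] :
          MvPolynomial (Fin 2) ℚ →ₐ[ℚ] Polynomial ℚ).toRingHom = eval ![t, y] := by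
      apply MvPolynomial.ringHom_ext
      · intro r
        simp
      · intro i
        fin_cases i <;> simp
    exact RingHom.congr_fun h q
  have hconst := Polynomial.eval_eq_eval_zero_of_periodic (Q := Q) (c := 2 * y)
    (by simpa using hy) (fun t => by simp only [hQ, hshift]) x
  rw [hQ, hQ] at hconst
  have h1 := hneg 0 y
  rw [neg_zero] at h1
  linarith [hodd 0 y]

theorem stmt9 (w : ℕ) (hw : Even w)
    (p : MvPolynomial (Fin 2) ℚ) (hp : memV w (-1) p) :
    (sub2 (X 0 + X 1) (X 1) p + sub2 (X 0) (X 0 + X 1) p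
        + sub2 (-X 0 + X 1) (X 1) p + sub2 (-X 0) (-X 0 + X 1) p = 0)
      ↔ ((p + sub2 (X 0 - X 1) (X 0) p + sub2 (-X 1) (X 0 - X 1) p = 0) ∧
          (sub2 (-X 1) (X 0) p + sub2 (-X 0) (X 0 - X 1) p
            + sub2 (-X 0 + X 1) (-X 1) p = 0)) := by
  obtain ⟨hhom, hX⟩ := hp
  have hoddX : ∀ x y : ℚ, eval ![-x, y] p = -eval ![x, y] p := by
    intro x y
    simpa [eval_sub2] using congrArg (eval ![x, y]) hX
  have hneg := eval_neg_neg hw hhom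
  have hoddY : ∀ x y : ℚ, eval ![x, -y] p = -eval ![x, y] p := by
    intro x y
    rw [← hneg x y, ← hoddX, neg_neg]
  let q := p + sub2 (X 0 - X 1) (X 0) p + sub2 (-X 1) (X 0 - X 1) p
  have hq : ∀ x y, eval ![x, y] q
      = eval ![x, y] p + eval ![x - y, x] p - eval ![y, x - y] p := by
    intro x y
    simp [q, eval_sub2, hoddX, sub_eq_add_neg]
  have hB : ∀ x y, eval ![x, y] (sub2 (-X 1) (X 0) p + sub2 (-X 0) (X 0 - X 1) p
      + sub2 (-X 0 + X 1) (-X 1) p) = -eval ![y, x] q := by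
    intro x y
    have h1 : -x + y = y - x := by ring
    have h2 := hoddY x (x - y)
    rw [neg_sub] at h2
    simp only [map_add, map_sub, map_neg, eval_sub2, eval_X, hq, Matrix.cons_val_zero,
      Matrix.cons_val_one, hoddX, hoddY, h1, h2]
    ring
  have hE : ∀ x y, eval ![x, y] (sub2 (X 0 + X 1) (X 1) p + sub2 (X 0) (X 0 + X 1) p
      + sub2 (-X 0 + X 1) (X 1) p + sub2 (-X 0) (-X 0 + X 1) p)
      = eval ![x + y, y] q + eval ![y, x] q := by
    intro x y
    have h1 : -x + y = y - x := by ring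
    have h2 : x + y - y = x := by ring
    simp only [map_add, map_neg, eval_sub2, eval_X, hq, Matrix.cons_val_zero,
      Matrix.cons_val_one, hoddX, h1, h2]
    ring
  rw [eq_zero_iff_eval_pair, eq_zero_iff_eval_pair (q := sub2 (-X 1) (X 0) p + _ + _)]
  simp only [hB, hE]
  change _ ↔ q = 0 ∧ _
  rw [eq_zero_iff_eval_pair]
  constructor
  · intro h
    have hU : ∀ x y, eval ![x - y, x] q = eval ![x, y] q := by
      intro x y
      have h1 : x - y - x = -y := by ring
      simp only [hq, h1, hoddX, hoddY]
      ring
    have hM : ∀ x y, eval ![x + y, x] q = -eval ![x, y] q := by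
      intro x y
      have h1 := h y x
      rw [add_comm y x] at h1
      linarith
    have hzero := eval_eq_zero_of_shift_invariant (q := q)
      (fun x y => by
        have h1 : -x - -y = -(x - y) := by ring
        simp only [hq, h1, hneg])
      (fun x y => by rw [← hM, ← hU, sub_neg_eq_add])
      (fun x y => by
        have h1 := hM y (x + y)
        have h2 := hU (x + y) x
        rw [add_sub_cancel_left, hM x y] at h2
        rw [h2, neg_neg] at h1
        rw [← h1]
        congr 3
        ring)
    exact ⟨hzero, fun x y => by rw [hzero, neg_zero]⟩
  · rintro ⟨h, -⟩ x y
    rw [h, h, add_zero]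
end
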